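/- Let n be a nonnegative integer and a, b, c, d, e, p, q, w ∈ ℂ. Assume a − q ≠ 0, 1+2q−w+n ≠ 0 and bc − p(a−p) ≠ 0, and set α = q(1+a−w)/(a−q), β = (q(1+a−w)+n(a−q))/(1+2q−w+n), γ = p(a−p)(b+c−a)/(bc − p(a−p)). Assume the parameters are nondegenerate for the identity below. Then ₉F₈(a, b, c, d, e, a−p+1, p+1, q+1, −n; 1+a−b, 1+a−c, 1+a−d, 1+a−e, p, a−p, q, w; 1) = ((w−a−1)_n (α+1)_n / ((w)_n (α)_n)) · Σ_{k=0}^{n} [ (−n)_k (a/2)_k ((a+1)/2)_k (1+a−w)_k (1+a−d−e)_k (β+1)_k / ( k! (1+a−d)_k (1+a−e)_k ((2+a−w−n)/2)_k ((3+a−w−n)/2)_k (β)_k ) ] · ₅F₄(−k, a−b−c, d, e, γ+1; 1+a−b, 1+a−c, d+e−a−k, γ; 1). -/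

import Mathlib

/-- Rising factorial (Pochhammer symbol) `(a)ₖ = a(a+1)⋯(a+k−1)`. -/
noncomputable def poch (a : ℂ) (k : ℕ) : ℂ := (ascPochhammer ℂ k).eval a

/-- Terminating hypergeometric sum with numerator parameters `A` together with
the extra top parameter `-n`, denominator parameters `B`, and argument `x`. -/
noncomputable def hypTerm (A B : List ℂ) (n : ℕ) (x : ℂ) : ℂ :=
  ∑ k ∈ Finset.range (n + 1),
    ((A.map fun a => poch a k).prod * poch (-(n : ℂ)) k) /
      ((k.factorial : ℂ) * (B.map fun b => poch b k).prod) * x ^ k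

open Finset

theorem poch_zero (a : ℂ) : poch a 0 = 1 := by simp [poch]

theorem poch_succ (a : ℂ) (k : ℕ) : poch a (k + 1) = poch a k * (a + k) := by
  simp [poch, ascPochhammer_succ_eval]

theorem poch_add (a : ℂ) (m k : ℕ) : poch a (m + k) = poch a m * poch (a + m) k := by
  induction k with
  | zero => simp [poch_zero]
  | succ k ih => rw [← add_assoc, poch_succ, ih, poch_succ]; push_cast; ring

theorem poch_succ_left (a : ℂ) (k : ℕ) : poch a (k + 1) = a * poch (a + 1) k := by
  rw [add_comm k 1, poch_add]; simp [poch_succ, poch_zero]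

theorem continuous_poch (k : ℕ) : Continuous fun a => poch a k :=
  (ascPochhammer ℂ k).continuous

theorem poch_shift_mul (a : ℂ) (k : ℕ) : a * poch (a + 1) k = poch a k * (a + k) := by
  rw [← poch_succ_left, poch_succ]

theorem poch_reflect (a : ℂ) (k : ℕ) : poch (1 - a - k) k = (-1) ^ k * poch a k := by
  induction k with
  | zero => simp [poch_zero]
  | succ k ih =>
    rw [poch_succ_left, poch_succ a, pow_succ]
    have h : (1 : ℂ) - a - ((k + 1 : ℕ) : ℂ) + 1 = 1 - a - k := by push_cast; ring
    rw [h, ih]; push_cast; ring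

theorem poch_neg_natCast (r k : ℕ) :
    poch (-(r : ℂ)) k = (-1) ^ k * ((k.factorial : ℂ) * (r.choose k : ℂ)) := by
  have h : (r.descFactorial k : ℂ) = k.factorial * r.choose k := by
    rw [Nat.descFactorial_eq_factorial_mul_choose]; push_cast; rfl
  rw [← h]
  clear h
  induction k with
  | zero => simp [poch_zero]
  | succ k ih =>
    rw [poch_succ, ih, Nat.descFactorial_succ]
    rcases le_or_gt k r with hk | hk
    · push_cast [Nat.cast_sub hk]; ring
    · simp [Nat.descFactorial_of_lt hk]

theorem poch_neg_natCast_of_lt {r k : ℕ} (h : r < k) : poch (-(r : ℂ)) k = 0 := by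
  simp [poch_neg_natCast, Nat.choose_eq_zero_of_lt h]

theorem poch_half_mul (a : ℂ) (k : ℕ) :
    poch (a / 2) k * poch ((a + 1) / 2) k * 4 ^ k = poch a (2 * k) := by
  induction k with
  | zero => simp [poch_zero]
  | succ k ih =>
    rw [show 2 * (k + 1) = 2 * k + 1 + 1 by ring, poch_succ a, poch_succ a, ← ih]
    simp only [poch_succ, pow_succ]
    push_cast; ring

theorem poch_ne_zero_of_le {a : ℂ} {m k : ℕ} (h : poch a k ≠ 0) (hm : m ≤ k) : poch a m ≠ 0 := by
  obtain ⟨s, rfl⟩ := Nat.exists_eq_add_of_le hm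
  rw [poch_add] at h
  exact left_ne_zero_of_mul h

theorem add_ne_zero_of_poch_ne_zero {a : ℂ} {m k : ℕ} (h : poch a k ≠ 0) (hm : m < k) :
    a + m ≠ 0 := by
  have := poch_ne_zero_of_le h (Nat.succ_le_of_lt hm)
  rw [poch_succ] at this
  exact right_ne_zero_of_mul this

theorem poch_succ_div (a : ℂ) (k : ℕ) (ha : a ≠ 0) (h : poch a k ≠ 0) :
    poch (a + 1) k / poch a k = (a + k) / a := by
  rw [div_eq_div_iff h ha, mul_comm, poch_shift_mul, mul_comm]

/-- Pascal's rule under an alternating binomial sum. -/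
theorem sum_choose_succ_alternating (N : ℕ) (f : ℕ → ℂ) :
    ∑ s ∈ range (N + 2), ((N + 1).choose s : ℂ) * (-1) ^ s * f s =
      ∑ s ∈ range (N + 1), (N.choose s : ℂ) * (-1) ^ s * (f s - f (s + 1)) := by
  have h1 : ∑ s ∈ range (N + 1), (N.choose s : ℂ) * (-1) ^ s * f s =
      ∑ s ∈ range (N + 1), (N.choose (s + 1) : ℂ) * (-1) ^ (s + 1) * f (s + 1) + f 0 := by
    have := sum_range_succ' (fun s => (N.choose s : ℂ) * (-1) ^ s * f s) (N + 1)
    rw [sum_range_succ] at this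
    simpa using this
  rw [sum_range_succ']
  simp only [mul_sub, sum_sub_distrib, h1, Nat.choose_succ_succ, Nat.cast_add, add_mul,
    sum_add_distrib, pow_succ]
  simp
  ring

theorem vandermonde_poch (N : ℕ) (A W : ℂ) :
    ∑ s ∈ range (N + 1), (N.choose s : ℂ) * (-1) ^ s * (poch A s * poch (W + s) (N - s)) =
      poch (W - A) N := by
  induction N generalizing W with
  | zero => simp [poch_zero]
  | succ N ih =>
    rw [sum_choose_succ_alternating, poch_succ_left, show W - A + 1 = W + 1 - A by ring, ← ih,
      mul_sum]
    refine sum_congr rfl fun s hs => ?_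
    have hs' : s ≤ N := Nat.lt_succ_iff.mp (mem_range.mp hs)
    rw [Nat.succ_sub hs', poch_succ_left (W + s), poch_succ A, Nat.add_sub_add_right]
    push_cast
    rw [show W + (s : ℂ) + 1 = W + 1 + s by ring, show W + ((s : ℂ) + 1) = W + 1 + s by ring]
    ring

theorem saalschutz_poch (r : ℕ) (u v x y : ℂ) (h : u + v = x + y + r - 1) :
    ∑ k ∈ range (r + 1), (r.choose k : ℂ) * (-1) ^ k *
        (poch u k * poch v k * poch (x + k) (r - k) * poch (y + k) (r - k)) =
      poch (x - u) r * poch (y - u) r := by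
  induction r generalizing u v x y with
  | zero => simp [poch_zero]
  | succ r ih =>
    have key : ∀ u v : ℂ, u + v = x + y + r → (u - v) *
        ∑ k ∈ range (r + 2), ((r + 1).choose k : ℂ) * (-1) ^ k *
          (poch u k * poch v k * poch (x + k) (r + 1 - k) * poch (y + k) (r + 1 - k)) =
        (u - v) * (poch (x - u) (r + 1) * poch (y - u) (r + 1)) := by
      intro u v huv
      have e1 := ih (u + 1) v (x + 1) (y + 1) (by linear_combination huv)
      have e2 := ih u (v + 1) (x + 1) (y + 1) (by linear_combination huv)
      have hv : v = x + y + r - u := by linear_combination huv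
      have split : (u - v) *
          ∑ k ∈ range (r + 2), ((r + 1).choose k : ℂ) * (-1) ^ k *
            (poch u k * poch v k * poch (x + k) (r + 1 - k) * poch (y + k) (r + 1 - k)) =
          u * ((x - v) * (y - v)) * (poch (x + 1 - (u + 1)) r * poch (y + 1 - (u + 1)) r) -
          v * ((x - u) * (y - u)) * (poch (x + 1 - u) r * poch (y + 1 - u) r) := by
        rw [← e1, ← e2, sum_choose_succ_alternating, mul_sum, mul_sum, mul_sum,
          ← sum_sub_distrib]
        refine sum_congr rfl fun k hk => ?_
        have hk' : k ≤ r := Nat.lt_succ_iff.mp (mem_range.mp hk)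
        rw [Nat.succ_sub hk', poch_succ_left (x + k), poch_succ_left (y + k), poch_succ u,
          poch_succ v, Nat.add_sub_add_right]
        push_cast
        rw [show x + (k : ℂ) + 1 = x + 1 + k by ring, show x + ((k : ℂ) + 1) = x + 1 + k by ring,
          show y + (k : ℂ) + 1 = y + 1 + k by ring, show y + ((k : ℂ) + 1) = y + 1 + k by ring]
        have hu := poch_shift_mul u k
        have hv' := poch_shift_mul v k
        linear_combination (-1 : ℂ) ^ k * (r.choose k : ℂ) * poch (x + 1 + k) (r - k) *
          poch (y + 1 + k) (r - k) *
          (-((x - v) * (y - v) * poch v k) * hu + (x - u) * (y - u) * poch u k * hv')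
      rw [split, show x + 1 - (u + 1) = x - u by ring, show y + 1 - (u + 1) = y - u by ring]
      have hx := poch_succ_left (x - u) r
      have hy := poch_succ_left (y - u) r
      rw [show x - u + 1 = x + 1 - u by ring] at hx
      rw [show y - u + 1 = y + 1 - u by ring] at hy
      have e3 : (x - u) * (y - u) * (poch (x + 1 - u) r * poch (y + 1 - u) r) =
        poch (x - u) (r + 1) * poch (y - u) (r + 1) := by rw [hx, hy]; ring
      have e4 : (x - v) * (y - v) * (poch (x - u) r * poch (y - u) r) =
        poch (x - u) (r + 1) * poch (y - u) (r + 1) := by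
        rw [poch_succ, poch_succ, hv]; ring
      linear_combination u * e4 - v * e3
    have hv : v = x + y + r - u := by push_cast at h; linear_combination h
    subst hv
    have hext := Continuous.ext_on (dense_compl_singleton ((x + y + r) / 2 : ℂ))
      (f := fun u => ∑ k ∈ range (r + 2), ((r + 1).choose k : ℂ) * (-1) ^ k *
          (poch u k * poch (x + y + r - u) k * poch (x + k) (r + 1 - k) *
            poch (y + k) (r + 1 - k)))
      (g := fun u => poch (x - u) (r + 1) * poch (y - u) (r + 1))
      (by
        have hc := fun k => (continuous_poch k)
        refine continuous_finsetSum _ fun k _ => ?_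
        have h2 := (hc k).comp (show Continuous fun u : ℂ => x + y + r - u by fun_prop)
        exact continuous_const.mul ((((hc k).mul h2).mul continuous_const).mul continuous_const))
      (((continuous_poch _).comp (show Continuous fun u : ℂ => x - u by fun_prop)).mul
        ((continuous_poch _).comp (show Continuous fun u : ℂ => y - u by fun_prop)))
      (fun u hu => by
        have hne : u - (x + y + r - u) ≠ 0 := by
          intro h0
          exact hu (by simp only [Set.mem_singleton_iff]; linear_combination h0 / 2)
        exact mul_left_cancel₀ hne (key u _ (by ring)))
    exact congrFun hext u

theorem sum_range_eq_of_forall_eq_zero {r N : ℕ} (hr : r ≤ N) (f : ℕ → ℂ)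
    (hf : ∀ k, r < k → f k = 0) :
    ∑ k ∈ range (N + 1), f k = ∑ k ∈ range (r + 1), f k := by
  refine (sum_subset (range_subset_range.mpr (by lia)) fun k _ hk => hf k ?_).symm
  simpa using hk

theorem saalschutz_div {r N : ℕ} (hr : r ≤ N) (a d e : ℂ) (hx : poch (1 + a - d) r ≠ 0)
    (hy : poch (1 + a - e) r ≠ 0) :
    ∑ k ∈ range (N + 1), poch (-(r : ℂ)) k * poch (a + r) k * poch (1 + a - d - e) k /
        ((k.factorial : ℂ) * poch (1 + a - d) k * poch (1 + a - e) k) =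
      poch d r * poch e r / (poch (1 + a - d) r * poch (1 + a - e) r) := by
  rw [sum_range_eq_of_forall_eq_zero hr _ fun k hk => by simp [poch_neg_natCast_of_lt hk]]
  have h := saalschutz_poch r (a + r) (1 + a - d - e) (1 + a - d) (1 + a - e) (by ring)
  have hd := poch_reflect d r
  have he := poch_reflect e r
  rw [show 1 + a - d - (a + r) = 1 - d - r by ring, show 1 + a - e - (a + r) = 1 - e - r by ring,
    hd, he] at h
  have hsq : ((-1 : ℂ) ^ r) * (-1) ^ r = 1 := by rw [← mul_pow]; simp
  rw [eq_div_iff (mul_ne_zero hx hy)]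
  calc _ = (((-1 : ℂ) ^ r) * (-1) ^ r) * (poch d r * poch e r) := by
        rw [show ((-1 : ℂ) ^ r) * (-1) ^ r * (poch d r * poch e r) =
          (-1) ^ r * poch d r * ((-1) ^ r * poch e r) by ring, ← h, sum_mul]
        refine sum_congr rfl fun k hk => ?_
        obtain ⟨s, rfl⟩ := Nat.exists_eq_add_of_le (Nat.lt_succ_iff.mp (mem_range.mp hk))
        have h1 := poch_ne_zero_of_le hx (Nat.le_add_right k s)
        have h2 := poch_ne_zero_of_le hy (Nat.le_add_right k s)
        have h3 : (k.factorial : ℂ) ≠ 0 := by exact_mod_cast k.factorial_ne_zero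
        rw [poch_neg_natCast, poch_add (1 + a - d) k s, poch_add (1 + a - e) k s,
          Nat.add_sub_cancel_left]
        field_simp
    _ = _ := by rw [hsq, one_mul]

theorem extended_saalschutz {r N : ℕ} (hr : r ≤ N) (a b c P γ : ℂ)
    (hx : poch (1 + a - b) r ≠ 0) (hy : poch (1 + a - c) r ≠ 0)
    (hP : P ≠ 0) (hγ : γ = P * (b + c - a) / (b * c - P)) (hγ0 : γ ≠ 0) (hγr : poch γ r ≠ 0) :
    ∑ j ∈ range (N + 1), poch (-(r : ℂ)) j * poch (a + r) j *
        (poch (a - b - c) j * poch (γ + 1) j /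
          ((j.factorial : ℂ) * poch (1 + a - b) j * poch (1 + a - c) j * poch γ j)) =
      poch b r * poch c r / (poch (1 + a - b) r * poch (1 + a - c) r) *
        ((P + r * (a + r)) / P) := by
  have ht : a - b - c ≠ 0 := by
    intro h
    apply hγ0
    rw [hγ, show b + c - a = -(a - b - c) by ring, h]; simp
  set R := poch b r * poch c r / (poch (1 + a - b) r * poch (1 + a - c) r) with hR
  set G : ℕ → ℂ := fun j => poch (-(r : ℂ)) j * poch (a + r) j * poch (a - b - c) j /
    ((j.factorial : ℂ) * poch (1 + a - b) j * poch (1 + a - c) j) with hG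
  have balanced : (a - b - c) * ∑ j ∈ range (N + 1), G j + ∑ j ∈ range (N + 1), j * G j =
      (a - b - c) * R := by
    rw [hR, ← saalschutz_div hr a b c hx hy, mul_sum, mul_sum, ← sum_add_distrib]
    refine sum_congr rfl fun j _ => ?_
    have h := poch_shift_mul (a - b - c) j
    rw [show a - b - c + 1 = 1 + a - b - c by ring] at h
    simp only [hG, div_eq_mul_inv]
    linear_combination (-(poch (-(r : ℂ)) j * poch (a + r) j *
      ((j.factorial : ℂ) * poch (1 + a - b) j * poch (1 + a - c) j)⁻¹)) * h
  have weighted : b * c * ∑ j ∈ range (N + 1), j * G j = -(r * (a + r) * (a - b - c) * R) := by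
    rcases r with _ | r
    · rw [sum_eq_zero]
      · simp
      · rintro (_ | j) _
        · simp
        · simp only [hG]
          rw [poch_neg_natCast_of_lt (Nat.succ_pos j)]; simp
    obtain ⟨M, rfl⟩ : ∃ M, N = M + 1 := ⟨N - 1, by lia⟩
    rw [poch_succ_left, show 1 + a - b + 1 = 1 + (a + 2) - (b + 1) by ring] at hx
    rw [poch_succ_left, show 1 + a - c + 1 = 1 + (a + 2) - (c + 1) by ring] at hy
    have hs := saalschutz_div (Nat.le_of_succ_le_succ hr) (a + 2) (b + 1) (c + 1)
      (right_ne_zero_of_mul hx) (right_ne_zero_of_mul hy)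
    have hR' : R = b * c / ((1 + a - b) * (1 + a - c)) * (poch (b + 1) r * poch (c + 1) r /
        (poch (1 + (a + 2) - (b + 1)) r * poch (1 + (a + 2) - (c + 1)) r)) := by
      rw [hR, poch_succ_left b, poch_succ_left c, poch_succ_left (1 + a - b),
        poch_succ_left (1 + a - c), show 1 + a - b + 1 = 1 + (a + 2) - (b + 1) by ring,
        show 1 + a - c + 1 = 1 + (a + 2) - (c + 1) by ring, div_mul_div_comm]
      congr 1 <;> ring
    rw [hR', ← hs, sum_range_succ', mul_sum, Nat.cast_zero, zero_mul, add_zero, mul_sum, mul_sum,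
      ← sum_neg_distrib]
    refine sum_congr rfl fun j _ => ?_
    simp only [hG]
    rw [poch_succ_left (-((r + 1 : ℕ) : ℂ)), poch_succ_left (a + ((r + 1 : ℕ) : ℂ)),
      poch_succ_left (a - b - c), poch_succ_left (1 + a - b), poch_succ_left (1 + a - c),
      Nat.factorial_succ]
    rw [show -((r + 1 : ℕ) : ℂ) + 1 = -r by push_cast; ring,
      show a + ((r + 1 : ℕ) : ℂ) + 1 = a + 2 + r by push_cast; ring,
      show a - b - c + 1 = 1 + (a + 2) - (b + 1) - (c + 1) by ring,
      show 1 + a - b + 1 = 1 + (a + 2) - (b + 1) by ring,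
      show 1 + a - c + 1 = 1 + (a + 2) - (c + 1) by ring]
    have hj : (j : ℂ) + 1 ≠ 0 := by exact_mod_cast Nat.succ_ne_zero j
    push_cast
    simp only [div_eq_mul_inv, mul_inv]
    linear_combination (-(b * c * (r + 1) * poch (-(r : ℂ)) j * (a + (r + 1)) *
      poch (a + 2 + r) j * (a - b - c) * poch (1 + (a + 2) - (b + 1) - (c + 1)) j *
      (j.factorial : ℂ)⁻¹ * (1 + a - b)⁻¹ * (poch (1 + (a + 2) - (b + 1)) j)⁻¹ *
      (1 + a - c)⁻¹ * (poch (1 + (a + 2) - (c + 1)) j)⁻¹)) * mul_inv_cancel₀ hj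
  have hsum : ∑ j ∈ range (N + 1), poch (-(r : ℂ)) j * poch (a + r) j *
        (poch (a - b - c) j * poch (γ + 1) j /
          ((j.factorial : ℂ) * poch (1 + a - b) j * poch (1 + a - c) j * poch γ j)) =
      ∑ j ∈ range (N + 1), G j + γ⁻¹ * ∑ j ∈ range (N + 1), j * G j := by
    rw [mul_sum, ← sum_add_distrib]
    refine sum_congr rfl fun j _ => ?_
    rcases lt_or_ge r j with hj | hj
    · simp [hG, poch_neg_natCast_of_lt hj]
    · have h := poch_succ_div γ j hγ0 (poch_ne_zero_of_le hγr hj)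
      have h2 : (γ + j) / γ = 1 + γ⁻¹ * j := by field_simp
      rw [mul_div_mul_comm, h, h2]
      simp only [hG]; ring
  have hγinv : γ⁻¹ = -(b * c - P) / (P * (a - b - c)) := by
    rw [hγ, inv_div, show b + c - a = -(a - b - c) by ring]
    rw [mul_neg, div_neg, neg_div]
  rw [hsum, hγinv]
  generalize ∑ j ∈ range (N + 1), G j = S0 at *
  generalize ∑ j ∈ range (N + 1), j * G j = S1 at *
  field_simp
  linear_combination P * balanced - weighted

theorem saalschutz_expansion {r N j : ℕ} (hr : r ≤ N) (hj : j ≤ N) (a d e : ℂ)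
    (hx : poch (1 + a - d) N ≠ 0) (hy : poch (1 + a - e) N ≠ 0)
    (hnd : ∀ k ≤ N, ∀ j ≤ k, poch (d + e - a - (k : ℂ)) j ≠ 0) :
    poch (-(r : ℂ)) j * poch (a + r) j *
        (poch d r * poch e r / (poch (1 + a - d) r * poch (1 + a - e) r)) =
      ∑ k ∈ range (N + 1), poch (-(r : ℂ)) k * poch (a + r) k *
        (poch (1 + a - d - e) k / ((k.factorial : ℂ) * poch (1 + a - d) k * poch (1 + a - e) k)) *
        (poch d j * poch e j * poch (-(k : ℂ)) j / poch (d + e - a - k) j) := by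
  rcases lt_or_ge r j with hrj | hrj
  · rw [poch_neg_natCast_of_lt hrj, sum_eq_zero]
    · simp
    intro k _
    rcases lt_or_ge k j with hkj | hkj
    · simp [poch_neg_natCast_of_lt hkj]
    · simp [poch_neg_natCast_of_lt (hrj.trans_le hkj)]
  obtain ⟨s, rfl⟩ := Nat.exists_eq_add_of_le hrj
  obtain ⟨M, rfl⟩ := Nat.exists_eq_add_of_le hj
  have hsM : s ≤ M := by lia
  have hx' := hx
  have hy' := hy
  rw [poch_add] at hx' hy'
  rw [show 1 + a - d + j = 1 + (a + 2 * j) - (d + j) by ring] at hx'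
  rw [show 1 + a - e + j = 1 + (a + 2 * j) - (e + j) by ring] at hy'
  have hs := saalschutz_div hsM (a + 2 * j) (d + j) (e + j)
    (poch_ne_zero_of_le (right_ne_zero_of_mul hx') hsM)
    (poch_ne_zero_of_le (right_ne_zero_of_mul hy') hsM)
  have hfront : ∀ k ∈ range j, poch (-((j + s : ℕ) : ℂ)) k * poch (a + (j + s : ℕ)) k *
        (poch (1 + a - d - e) k / ((k.factorial : ℂ) * poch (1 + a - d) k * poch (1 + a - e) k)) *
        (poch d j * poch e j * poch (-(k : ℂ)) j / poch (d + e - a - k) j) = 0 := by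
    intro k hk
    simp [poch_neg_natCast_of_lt (mem_range.mp hk)]
  rw [add_assoc, sum_range_add, sum_eq_zero hfront, zero_add, poch_add d, poch_add e,
    poch_add (1 + a - d), poch_add (1 + a - e),
    show 1 + a - d + j = 1 + (a + 2 * j) - (d + j) by ring,
    show 1 + a - e + j = 1 + (a + 2 * j) - (e + j) by ring,
    show ∀ p q r s t u v w : ℂ, p * q * (r * s * (t * u) / (v * w)) =
      p * q * r * t * (s * u / (v * w)) from fun _ _ _ _ _ _ _ _ => by ring,
    mul_mul_mul_comm (poch (1 + a - d) j), mul_comm (_ * _) (poch _ s * poch _ s),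
    div_mul_eq_div_div, ← hs, div_eq_mul_inv _ (_ * _), sum_mul, mul_sum]
  refine sum_congr rfl fun m hm => ?_
  have hmM : m ≤ M := Nat.lt_succ_iff.mp (mem_range.mp hm)
  have hk := hnd (j + m) (by lia) j (by lia)
  have hrefl := poch_reflect (1 + a - d - e + m) j
  rw [show 1 - (1 + a - d - e + m) - (j : ℂ) = d + e - a - (j + m : ℕ) by push_cast; ring] at hrefl
  rw [hrefl] at hk
  rw [hrefl, show poch (1 + a - d - e) (j + m) = poch (1 + a - d - e) m *
    poch (1 + a - d - e + m) j by rw [add_comm j m, poch_add], poch_neg_natCast (j + m) j,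
    poch_add (-((j + s : ℕ) : ℂ)) j m, poch_add (a + (j + s : ℕ)) j m,
    poch_add (1 + a - d) j m, poch_add (1 + a - e) j m,
    show -((j + s : ℕ) : ℂ) + j = -s by push_cast; ring,
    show a + ((j + s : ℕ) : ℂ) + j = a + 2 * j + s by push_cast; ring,
    show 1 + a - d + j = 1 + (a + 2 * j) - (d + j) by ring,
    show 1 + a - e + j = 1 + (a + 2 * j) - (e + j) by ring,
    show 1 + (a + 2 * j) - (d + j) - (e + j) = 1 + a - d - e by ring]
  have hfac : ((j + m).factorial : ℂ) = (j.factorial : ℂ) * ((j + m).choose j : ℂ) *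
      (m.factorial : ℂ) := by
    have := Nat.choose_mul_factorial_mul_factorial (Nat.le_add_right j m)
    rw [Nat.add_sub_cancel_left] at this
    rw [← this]; push_cast; ring
  have h1 : (j.factorial : ℂ) * ((j + m).choose j : ℂ) ≠ 0 := by
    have := (Nat.choose_pos (Nat.le_add_right j m)).ne'
    exact mul_ne_zero (by exact_mod_cast j.factorial_ne_zero) (by exact_mod_cast this)
  have h2 : (m.factorial : ℂ) ≠ 0 := by exact_mod_cast m.factorial_ne_zero
  have h3 : poch (1 + a - d - e + m) j ≠ 0 := right_ne_zero_of_mul hk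
  have h4 := poch_ne_zero_of_le hx (Nat.le_add_right j M)
  have h5 := poch_ne_zero_of_le hy (Nat.le_add_right j M)
  have h6 := poch_ne_zero_of_le (right_ne_zero_of_mul hx') hmM
  have h7 := poch_ne_zero_of_le (right_ne_zero_of_mul hy') hmM
  rw [hfac]
  generalize (j.factorial : ℂ) * ((j + m).choose j : ℂ) = F at *
  field_simp

theorem weighted_vandermonde_poch (N : ℕ) (A W : ℂ) :
    (W - A - 1) * ∑ s ∈ range (N + 1),
        (N.choose s : ℂ) * (-1) ^ s * (poch A s * poch (W + s) (N - s)) * s =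
      -(A * N * poch (W - A - 1) N) := by
  rcases N with _ | M
  · simp
  have h := vandermonde_poch M (A + 1) (W + 1)
  rw [show W + 1 - (A + 1) = W - A - 1 + 1 by ring] at h
  rw [poch_succ_left (W - A - 1), ← h, sum_range_succ', Nat.cast_zero, mul_zero, add_zero,
    mul_sum, mul_sum, mul_sum, ← sum_neg_distrib]
  refine sum_congr rfl fun s _ => ?_
  have hc : ((M + 1 : ℕ) : ℂ) * (M.choose s : ℂ) =
      ((M + 1).choose (s + 1) : ℂ) * ((s + 1 : ℕ) : ℂ) := by
    exact_mod_cast Nat.add_one_mul_choose_eq M s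
  rw [poch_succ_left, Nat.add_sub_add_right,
    show W + ((s + 1 : ℕ) : ℂ) = W + 1 + s by push_cast; ring, pow_succ]
  linear_combination (W - A - 1) * (-1) ^ s * A * poch (A + 1) s * poch (W + 1 + s) (M - s) * hc

theorem weighted_vandermonde_div (N : ℕ) (A W Q : ℂ) (hW : poch W N ≠ 0) :
    (W - A - 1) * poch W N * ∑ s ∈ range (N + 1),
        poch A s * poch (-(N : ℂ)) s * (Q + s) / ((s.factorial : ℂ) * poch W s) =
      poch (W - A - 1) N * (Q * (W - A - 1 + N) - A * N) := by
  have h1 := vandermonde_poch N A W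
  have h2 := weighted_vandermonde_poch N A W
  have h3 := poch_shift_mul (W - A - 1) N
  rw [sub_add_cancel, ← h1] at h3
  have h4 : poch W N * ∑ s ∈ range (N + 1),
        poch A s * poch (-(N : ℂ)) s * (Q + s) / ((s.factorial : ℂ) * poch W s) =
      Q * ∑ s ∈ range (N + 1), (N.choose s : ℂ) * (-1) ^ s * (poch A s * poch (W + s) (N - s)) +
      ∑ s ∈ range (N + 1), (N.choose s : ℂ) * (-1) ^ s * (poch A s * poch (W + s) (N - s)) * s := by
    rw [mul_sum, mul_sum, ← sum_add_distrib]
    refine sum_congr rfl fun s hs => ?_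
    obtain ⟨m, rfl⟩ := Nat.exists_eq_add_of_le (Nat.lt_succ_iff.mp (mem_range.mp hs))
    have h5 := poch_ne_zero_of_le hW (Nat.le_add_right s m)
    have h6 : (s.factorial : ℂ) ≠ 0 := by exact_mod_cast s.factorial_ne_zero
    rw [poch_neg_natCast, poch_add W s m, Nat.add_sub_cancel_left]
    field_simp
  rw [mul_assoc, h4]
  linear_combination Q * h3 + h2

theorem well_poised_expansion {r N : ℕ} (hr : r ≤ N) (a b c d e p γ : ℂ)
    (hb : poch (1 + a - b) N ≠ 0) (hc : poch (1 + a - c) N ≠ 0)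
    (hd : poch (1 + a - d) N ≠ 0) (he : poch (1 + a - e) N ≠ 0)
    (hp : p * (a - p) ≠ 0)
    (hγ : γ = p * (a - p) * (b + c - a) / (b * c - p * (a - p))) (hγ0 : γ ≠ 0)
    (hγN : poch γ N ≠ 0)
    (hnd : ∀ k ≤ N, ∀ j ≤ k, poch (d + e - a - (k : ℂ)) j ≠ 0) :
    poch b r * poch c r / (poch (1 + a - b) r * poch (1 + a - c) r) *
        (((p + r) * (a - p + r)) / (p * (a - p))) *
        (poch d r * poch e r / (poch (1 + a - d) r * poch (1 + a - e) r)) =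
      ∑ k ∈ range (N + 1), poch (-(r : ℂ)) k * poch (a + r) k *
        (poch (1 + a - d - e) k / ((k.factorial : ℂ) * poch (1 + a - d) k * poch (1 + a - e) k) *
          hypTerm [a - b - c, d, e, γ + 1]
            [1 + a - b, 1 + a - c, d + e - a - (k : ℂ), γ] k 1) := by
  rw [show (p + r) * (a - p + r) = p * (a - p) + r * (a + r) by ring,
    ← extended_saalschutz hr a b c (p * (a - p)) γ (poch_ne_zero_of_le hb hr)
      (poch_ne_zero_of_le hc hr) hp hγ hγ0 (poch_ne_zero_of_le hγN hr), sum_mul]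
  have hterm : ∀ j ∈ range (N + 1), poch (-(r : ℂ)) j * poch (a + r) j *
        (poch (a - b - c) j * poch (γ + 1) j /
          ((j.factorial : ℂ) * poch (1 + a - b) j * poch (1 + a - c) j * poch γ j)) *
        (poch d r * poch e r / (poch (1 + a - d) r * poch (1 + a - e) r)) =
      (poch (a - b - c) j * poch (γ + 1) j /
          ((j.factorial : ℂ) * poch (1 + a - b) j * poch (1 + a - c) j * poch γ j)) *
      ∑ k ∈ range (N + 1), poch (-(r : ℂ)) k * poch (a + r) k *
        (poch (1 + a - d - e) k / ((k.factorial : ℂ) * poch (1 + a - d) k * poch (1 + a - e) k)) *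
        (poch d j * poch e j * poch (-(k : ℂ)) j / poch (d + e - a - k) j) := by
    intro j hj
    rw [← saalschutz_expansion hr (Nat.lt_succ_iff.mp (mem_range.mp hj)) a d e hd he hnd]
    ring
  rw [sum_congr rfl hterm]
  simp only [mul_sum]
  rw [sum_comm]
  refine sum_congr rfl fun k hk => ?_
  have hk' : k ≤ N := Nat.lt_succ_iff.mp (mem_range.mp hk)
  rw [sum_range_eq_of_forall_eq_zero hk' _ fun j hj => by simp [poch_neg_natCast_of_lt hj], hypTerm,
    mul_sum, mul_sum]
  refine sum_congr rfl fun j _ => ?_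
  simp only [List.map_cons, List.map_nil, List.prod_cons, List.prod_nil, one_pow, div_eq_mul_inv,
    mul_inv]
  ring

theorem sum_shift_to_vandermonde (k N : ℕ) (a q w : ℂ) (hw : poch w (k + N) ≠ 0) :
    ∑ r ∈ range (k + N + 1), poch a r * poch (-((k + N : ℕ) : ℂ)) r * (q + r) /
        ((r.factorial : ℂ) * poch w r) * (poch (-(r : ℂ)) k * poch (a + r) k) =
      (-1) ^ k * poch a (2 * k) * poch (-((k + N : ℕ) : ℂ)) k / poch w k *
        ∑ s ∈ range (N + 1), poch (a + 2 * k) s * poch (-(N : ℂ)) s * (q + k + s) /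
          ((s.factorial : ℂ) * poch (w + k) s) := by
  rw [add_assoc, sum_range_add, sum_eq_zero, zero_add, mul_sum]
  · refine sum_congr rfl fun s hs => ?_
    have hsN : s ≤ N := Nat.lt_succ_iff.mp (mem_range.mp hs)
    have ha : poch a (k + s) * poch (a + (k + s : ℕ)) k = poch a (2 * k) * poch (a + 2 * k) s := by
      rw [← poch_add, show k + s + k = 2 * k + s by ring, poch_add]; push_cast; rfl
    have hfac : ((k + s).factorial : ℂ) = (k.factorial : ℂ) * ((k + s).choose k : ℂ) *
        (s.factorial : ℂ) := by
      have := Nat.choose_mul_factorial_mul_factorial (Nat.le_add_right k s)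
      rw [Nat.add_sub_cancel_left] at this
      rw [← this]; push_cast; ring
    have h1 : (k.factorial : ℂ) * ((k + s).choose k : ℂ) ≠ 0 := by
      have := (Nat.choose_pos (Nat.le_add_right k s)).ne'
      exact mul_ne_zero (by exact_mod_cast k.factorial_ne_zero) (by exact_mod_cast this)
    have h2 : (s.factorial : ℂ) ≠ 0 := by exact_mod_cast s.factorial_ne_zero
    have h3 : poch w k ≠ 0 := poch_ne_zero_of_le hw (Nat.le_add_right k N)
    rw [poch_add] at hw
    have h4 := poch_ne_zero_of_le (right_ne_zero_of_mul hw) hsN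
    rw [poch_neg_natCast (k + s) k, poch_add w, poch_add (-((k + N : ℕ) : ℂ)),
      show -((k + N : ℕ) : ℂ) + k = -N by push_cast; ring, hfac,
      show q + ((k + s : ℕ) : ℂ) = q + k + s by push_cast; ring]
    generalize (k.factorial : ℂ) * ((k + s).choose k : ℂ) = F at *
    generalize poch (a + 2 * (k : ℂ)) s = D at *
    field_simp
    linear_combination poch (-((k + N : ℕ) : ℂ)) k * poch (-(N : ℂ)) s * (q + k + s) * ha
  · intro r hr
    simp [poch_neg_natCast_of_lt (mem_range.mp hr)]

theorem poch_reflection_identity (z : ℂ) (k N : ℕ) :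
    (-1) ^ k * poch (z - k) N * z * poch (1 - z - (k + N : ℕ)) (2 * k) =
      (z - k) * poch z (k + N) * poch (-z) k := by
  have h1 := poch_reflect (z - k + N) (2 * k)
  rw [pow_mul, neg_one_sq, one_pow, one_mul,
    show 1 - (z - k + N) - ((2 * k : ℕ) : ℂ) = 1 - z - (k + N : ℕ) by push_cast; ring] at h1
  have h2 : poch (z - k) N * poch (z - k + N) (2 * k) = poch (z - k) k * poch z (k + N) := by
    rw [← poch_add, show N + 2 * k = k + (k + N) by ring, poch_add, sub_add_cancel]
  have h3 := poch_reflect (z - k + 1) k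
  rw [show 1 - (z - k + 1) - (k : ℂ) = -z by ring] at h3
  have h4 := poch_shift_mul (z - k) k
  rw [sub_add_cancel] at h4
  rw [h1, h3]
  linear_combination (-1) ^ k * z * h2 - (-1) ^ k * poch z (k + N) * h4

theorem sum_eq_prefactor (k N : ℕ) (a q w α β : ℂ) (hn : 0 < k + N)
    (haq : a - q ≠ 0) (hqw : 1 + 2 * q - w + ((k + N : ℕ) : ℂ) ≠ 0)
    (hα : α = q * (1 + a - w) / (a - q))
    (hβ : β = (q * (1 + a - w) + ((k + N : ℕ) : ℂ) * (a - q)) /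
      (1 + 2 * q - w + ((k + N : ℕ) : ℂ)))
    (hα0 : α ≠ 0) (hβ0 : β ≠ 0) (hw : poch w (k + N) ≠ 0)
    (h2 : poch (2 + a - w - (k + N : ℕ)) (2 * (k + N)) ≠ 0) :
    q⁻¹ * ((-1) ^ k / poch w k *
        ∑ s ∈ range (N + 1), poch (a + 2 * k) s * poch (-(N : ℂ)) s * (q + k + s) /
          ((s.factorial : ℂ) * poch (w + k) s)) =
      poch (w - a - 1) (k + N) / poch w (k + N) * ((α + (k + N : ℕ)) / α) *
        (poch (1 + a - w) k / poch (2 + a - w - (k + N : ℕ)) (2 * k) * ((β + k) / β)) := by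
  obtain ⟨z, rfl⟩ : ∃ z, w = z + a + 1 := ⟨w - a - 1, by ring⟩
  have hq : q ≠ 0 := by rintro rfl; simp [hα] at hα0
  have hz : z ≠ 0 := by
    rintro rfl
    exact hα0 (by rw [hα]; ring)
  have hzk : z - k ≠ 0 := by
    have h := add_ne_zero_of_poch_ne_zero h2 (m := k + N - 1 + k) (by lia)
    rw [Nat.cast_add (k + N - 1), Nat.cast_pred hn] at h
    intro h0
    apply h
    push_cast
    linear_combination -h0
  have hden := poch_ne_zero_of_le h2 (show 2 * k ≤ 2 * (k + N) by lia)
  have hwk : poch (z + a + 1) k ≠ 0 := poch_ne_zero_of_le hw (Nat.le_add_right k N)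
  rw [poch_add (z + a + 1)] at hw ⊢
  have hwN := right_ne_zero_of_mul hw
  have hV := weighted_vandermonde_div N (a + 2 * k) (z + a + 1 + k) (q + k) hwN
  have hcomb := poch_reflection_identity z k N
  rw [show z + a + 1 + k - (a + 2 * k) - 1 = z - k by ring] at hV
  rw [show 2 + a - (z + a + 1) - ((k + N : ℕ) : ℂ) = 1 - z - (k + N : ℕ) by ring] at hden ⊢
  rw [show z + a + 1 - a - 1 = z by ring, show 1 + a - (z + a + 1) = -z by ring] at *
  set S := ∑ s ∈ range (N + 1), poch (a + 2 * k) s * poch (-(N : ℂ)) s * (q + k + s) /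
          ((s.factorial : ℂ) * poch (z + a + 1 + k) s)
  set Y := 1 + 2 * q - (z + a + 1) + ((k + N : ℕ) : ℂ) with hY
  set X := q * -z + ((k + N : ℕ) : ℂ) * (a - q) with hX
  have hX0 : X ≠ 0 := by
    intro h; apply hβ0; rw [hβ, h, zero_div]
  have hαβ : (α + (k + N : ℕ)) / α * ((β + k) / β) = (X + k * Y) / (q * -z) := by
    have e1 : (α + (k + N : ℕ)) / α = X / (q * -z) := by
      rw [hα, hX]; field_simp
    have e2 : (β + k) / β = (X + k * Y) / X := by
      rw [hβ]; field_simp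
    rw [e1, e2]; field_simp
  have hS : S = -(poch (z - k) N * (X + k * Y)) / ((z - k) * poch (z + a + 1 + k) N) := by
    rw [eq_div_iff (mul_ne_zero hzk hwN), mul_comm, hV, hX, hY]
    push_cast; ring
  rw [show ∀ u v s t m : ℂ, u / v * s * (t / m * ((β + k) / β)) =
    u / v * (t / m) * (s * ((β + k) / β)) from fun _ _ _ _ _ => by ring, hαβ, hS]
  clear_value X Y
  clear hV hS hαβ hβ hX hY
  field_simp
  linear_combination (-(X + k * Y)) * hcomb

theorem proposition_11P2 (n : ℕ) (a b c d e p q w : ℂ)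
    (haq : a - q ≠ 0) (hqw : 1 + 2 * q - w + (n : ℂ) ≠ 0)
    (hbc : b * c - p * (a - p) ≠ 0)
    (α β γ : ℂ)
    (hα : α = q * (1 + a - w) / (a - q))
    (hβ : β = (q * (1 + a - w) + (n : ℂ) * (a - q)) / (1 + 2 * q - w + (n : ℂ)))
    (hγ : γ = p * (a - p) * (b + c - a) / (b * c - p * (a - p)))
    (hnd : ∀ z ∈ [1 + a - b, 1 + a - c, 1 + a - d, 1 + a - e, p, a - p, q, w,
        (2 + a - w - (n : ℂ)) / 2, (3 + a - w - (n : ℂ)) / 2, β, γ, α],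
      ∀ k ≤ n, poch z k ≠ 0)
    (hnd' : ∀ k ≤ n, ∀ j ≤ k, poch (d + e - a - (k : ℂ)) j ≠ 0) :
    hypTerm [a, b, c, d, e, a - p + 1, p + 1, q + 1]
        [1 + a - b, 1 + a - c, 1 + a - d, 1 + a - e, p, a - p, q, w] n 1
      = poch (w - a - 1) n * poch (α + 1) n / (poch w n * poch α n) *
        ∑ k ∈ Finset.range (n + 1),
          (poch (-(n : ℂ)) k * poch (a / 2) k * poch ((a + 1) / 2) k * poch (1 + a - w) k *
              poch (1 + a - d - e) k * poch (β + 1) k) /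
            ((k.factorial : ℂ) * poch (1 + a - d) k * poch (1 + a - e) k *
              poch ((2 + a - w - (n : ℂ)) / 2) k * poch ((3 + a - w - (n : ℂ)) / 2) k *
              poch β k) *
          hypTerm [a - b - c, d, e, γ + 1]
            [1 + a - b, 1 + a - c, d + e - a - (k : ℂ), γ] k 1 := by
  rcases Nat.eq_zero_or_pos n with rfl | hn
  · simp [hypTerm, poch_zero]
  have hne : ∀ z ∈ [1 + a - b, 1 + a - c, 1 + a - d, 1 + a - e, p, a - p, q, w,
        (2 + a - w - (n : ℂ)) / 2, (3 + a - w - (n : ℂ)) / 2, β, γ, α], poch z n ≠ 0 :=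
    fun z hz => hnd z hz n le_rfl
  simp only [List.mem_cons, List.not_mem_nil, or_false, forall_eq_or_imp, forall_eq] at hne
  obtain ⟨hb, hc, hd, he, hp, hap, hq, hw, hh1, hh2, hβn, hγn, hαn⟩ := hne
  have base : ∀ {z : ℂ}, poch z n ≠ 0 → z ≠ 0 := fun h => by
    simpa using add_ne_zero_of_poch_ne_zero h hn
  have hp0 := base hp
  have hap0 := base hap
  have hq0 := base hq
  have hβ0 := base hβn
  have hα0 := base hαn
  have hhalf : poch (2 + a - w - n) (2 * n) ≠ 0 := by
    rw [← poch_half_mul, show 2 + a - w - (n : ℂ) + 1 = 3 + a - w - n by ring]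
    exact mul_ne_zero (mul_ne_zero hh1 hh2) (pow_ne_zero _ (by norm_num))
  set C : ℕ → ℂ := fun k =>
    poch (1 + a - d - e) k / ((k.factorial : ℂ) * poch (1 + a - d) k * poch (1 + a - e) k) *
      hypTerm [a - b - c, d, e, γ + 1]
        [1 + a - b, 1 + a - c, d + e - a - (k : ℂ), γ] k 1 with hC
  have hleft : hypTerm [a, b, c, d, e, a - p + 1, p + 1, q + 1]
        [1 + a - b, 1 + a - c, 1 + a - d, 1 + a - e, p, a - p, q, w] n 1 =
      ∑ r ∈ range (n + 1), ∑ k ∈ range (n + 1), q⁻¹ * C k *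
        (poch a r * poch (-(n : ℂ)) r * (q + r) / ((r.factorial : ℂ) * poch w r) *
          (poch (-(r : ℂ)) k * poch (a + r) k)) := by
    rw [hypTerm]
    refine sum_congr rfl fun r hr => ?_
    have hr' : r ≤ n := Nat.lt_succ_iff.mp (mem_range.mp hr)
    have hexp := well_poised_expansion hr' a b c d e p γ hb hc hd he (mul_ne_zero hp0 hap0) hγ
      (base hγn) hγn hnd'
    have e1 := poch_succ_div p r hp0 (poch_ne_zero_of_le hp hr')
    have e2 := poch_succ_div (a - p) r hap0 (poch_ne_zero_of_le hap hr')
    have e3 := poch_succ_div q r hq0 (poch_ne_zero_of_le hq hr')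
    calc _ = q⁻¹ * (poch a r * poch (-(n : ℂ)) r * (q + r) / ((r.factorial : ℂ) * poch w r)) *
          (poch b r * poch c r / (poch (1 + a - b) r * poch (1 + a - c) r) *
            (((p + r) * (a - p + r)) / (p * (a - p))) *
            (poch d r * poch e r / (poch (1 + a - d) r * poch (1 + a - e) r))) := by
          have e3' : q + r = q * (poch (q + 1) r / poch q r) := by rw [e3]; field_simp
          rw [mul_div_mul_comm (p + (r : ℂ)), ← e1, ← e2, e3']
          simp only [List.map_cons, List.map_nil, List.prod_cons, List.prod_nil, one_pow,
            div_eq_mul_inv, mul_inv]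
          have := mul_inv_cancel₀ hq0
          linear_combination (-(poch a r * poch (-(n : ℂ)) r * poch (q + 1) r * (poch q r)⁻¹ *
            (r.factorial : ℂ)⁻¹ * (poch w r)⁻¹ * poch b r * poch c r * (poch (1 + a - b) r)⁻¹ *
            (poch (1 + a - c) r)⁻¹ * poch (p + 1) r * (poch p r)⁻¹ * poch (a - p + 1) r *
            (poch (a - p) r)⁻¹ * poch d r * poch e r * (poch (1 + a - d) r)⁻¹ *
            (poch (1 + a - e) r)⁻¹)) * this
      _ = _ := by
          rw [hexp, mul_sum]
          refine sum_congr rfl fun k _ => ?_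
          rw [hC]; ring
  rw [hleft, sum_comm, mul_sum]
  refine sum_congr rfl fun k hk => ?_
  obtain ⟨N, rfl⟩ := Nat.exists_eq_add_of_le (Nat.lt_succ_iff.mp (mem_range.mp hk))
  have hfinal := sum_eq_prefactor k N a q w α β hn haq hqw hα hβ hα0 hβ0 hw hhalf
  have hkn : k ≤ k + N := Nat.le_add_right k N
  have hden := poch_half_mul (2 + a - w - (k + N : ℕ)) k
  rw [show 2 + a - w - ((k + N : ℕ) : ℂ) + 1 = 3 + a - w - (k + N : ℕ) by ring] at hden
  have h4 : (4 : ℂ) ^ k ≠ 0 := pow_ne_zero _ (by norm_num)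
  have hratio : poch a (2 * k) / poch (2 + a - w - (k + N : ℕ)) (2 * k) =
      poch (a / 2) k * poch ((a + 1) / 2) k /
        (poch ((2 + a - w - (k + N : ℕ)) / 2) k * poch ((3 + a - w - (k + N : ℕ)) / 2) k) := by
    rw [← hden, ← poch_half_mul, mul_div_mul_right _ _ h4]
  rw [← mul_sum, sum_shift_to_vandermonde k N a q w hw]
  calc _ = C k * poch (-((k + N : ℕ) : ℂ)) k * poch a (2 * k) * (q⁻¹ * ((-1) ^ k / poch w k *
        ∑ s ∈ range (N + 1), poch (a + 2 * k) s * poch (-(N : ℂ)) s * (q + k + s) /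
          ((s.factorial : ℂ) * poch (w + k) s))) := by ring
    _ = C k * poch (-((k + N : ℕ) : ℂ)) k *
        (poch a (2 * k) / poch (2 + a - w - (k + N : ℕ)) (2 * k)) *
        (poch (w - a - 1) (k + N) / poch w (k + N) * ((α + (k + N : ℕ)) / α) *
          (poch (1 + a - w) k * ((β + k) / β))) := by rw [hfinal]; ring
    _ = _ := by
        rw [hratio, ← poch_succ_div α _ hα0 hαn,
          ← poch_succ_div β k hβ0 (poch_ne_zero_of_le hβn hkn)]
        simp only [hC, div_eq_mul_inv, mul_inv]
        ring
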